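/- Let X be a string and k ≥ 2 an integer. Let b be the number of k-breaks in X, i.e., positions i that are multiples of k with 0 ≤ i ≤ |X| − 3k such that the substring X[i..i+3k) has smallest period greater than k. Then b/3 ≤ BP_k(X) ≤ b + 3, where BP_k(X) is the k-block periodicity of X. -/

import Mathlib

/-- `S` has period `q`: characters at distance `q` agree. -/
def HasPeriod {α : Type*} (S : List α) (q : ℕ) : Prop :=
  ∀ i, i + q < S.length → S[i]? = S[i + q]?

/-- `S` is `p`-periodic: it has some period `q` with `1 ≤ q ≤ p`. -/
def IsPeriodic {α : Type*} (p : ℕ) (S : List α) : Prop :=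
  ∃ q, 1 ≤ q ∧ q ≤ p ∧ HasPeriod S q

/-- The `p`-block periodicity of `X`: the smallest number of blocks in a partition of
`X` into `p`-periodic substrings. -/
noncomputable def BP {α : Type*} (p : ℕ) (X : List α) : ℕ :=
  sInf {L | ∃ parts : List (List α), parts.length = L ∧ parts.flatten = X ∧
    ∀ P ∈ parts, IsPeriodic p P}

open Classical in
/-- The set of `k`-breaks of `X`: positions `i` that are multiples of `k` with
`i + 3k ≤ |X|` such that `X[i..i+3k)` is not `k`-periodic. -/
noncomputable def breaks {α : Type*} (k : ℕ) (X : List α) : Finset ℕ :=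
  (Finset.range (X.length + 1)).filter
    (fun i => k ∣ i ∧ i + 3 * k ≤ X.length ∧ ¬ IsPeriodic k ((X.drop i).take (3 * k)))

/-- `X` restricted to `[a, b)` has a period at most `k`. -/
def PerOn {α : Type*} (k : ℕ) (X : List α) (a b : ℕ) : Prop :=
  ∃ q, 1 ≤ q ∧ q ≤ k ∧ ∀ i, a ≤ i → i + q < b → X[i]? = X[i + q]?

theorem perOn_iff {α : Type*} (k : ℕ) (X : List α) (a b : ℕ) (hab : a ≤ b)
    (hb : b ≤ X.length) : IsPeriodic k ((X.drop a).take (b - a)) ↔ PerOn k X a b := by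
  unfold IsPeriodic PerOn HasPeriod
  refine exists_congr fun q => and_congr_right fun h1 => and_congr_right fun h2 => ?_
  constructor
  · intro h i hi hib
    have := h (i - a) (by simp; omega)
    rw [List.getElem?_take_of_lt (by omega), List.getElem?_take_of_lt (by omega),
      List.getElem?_drop, List.getElem?_drop] at this
    rwa [show a + (i - a) = i by omega, show a + (i - a + q) = i + q by omega] at this
  · intro h i hi
    simp only [List.length_take, List.length_drop] at hi
    rw [List.getElem?_take_of_lt (by omega), List.getElem?_take_of_lt (by omega),
      List.getElem?_drop, List.getElem?_drop]
    have := h (a + i) (by omega) (by omega)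
    rwa [add_assoc] at this

theorem perOn_mono {α : Type*} {k : ℕ} {X : List α} {a b a' b' : ℕ} (ha : a ≤ a')
    (hb : b' ≤ b) (h : PerOn k X a b) : PerOn k X a' b' := by
  obtain ⟨q, h1, h2, h⟩ := h
  exact ⟨q, h1, h2, fun i hi hi' => h i (by omega) (by omega)⟩

theorem perOn_short {α : Type*} {k : ℕ} (hk : 1 ≤ k) {X : List α} {a b : ℕ}
    (hb : b ≤ a + k) : PerOn k X a b :=
  ⟨k, hk, le_rfl, fun i hi hi' => by omega⟩

theorem perOn_merge {α : Type*} {k : ℕ} {X : List α} {a b c d : ℕ} (hab : a ≤ b)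
    (hc : b + 2 * k ≤ c) (h : PerOn k X a c) (h' : PerOn k X b d) : PerOn k X a d := by
  obtain ⟨p, hp1, hpk, hp⟩ := h
  obtain ⟨q, hq1, hqk, hq⟩ := h'
  refine ⟨p, hp1, hpk, fun i => ?_⟩
  induction i using Nat.strong_induction_on with
  | _ i ih =>
    intro hi hid
    by_cases hic : i + p < c
    · exact hp i hi hic
    · have e1 := hq (i - q) (by omega) (by omega)
      have e2 := hq (i - q + p) (by omega) (by omega)
      have e3 := ih (i - q) (by omega) (by omega) (by omega)
      rw [show i - q + q = i by omega] at e1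
      rw [show i - q + p + q = i + p by omega] at e2
      rw [← e1, e3, e2]

/-- The prefix of length `a` splits into at most `c` periodic blocks. -/
def Cov {α : Type*} (k : ℕ) (X : List α) (a c : ℕ) : Prop :=
  ∃ parts : List (List α), parts.length ≤ c ∧ parts.flatten = X.take a ∧
    ∀ P ∈ parts, IsPeriodic k P

theorem cov_mono {α : Type*} {k : ℕ} {X : List α} {a c c' : ℕ} (h : Cov k X a c)
    (hc : c ≤ c') : Cov k X a c' := by
  obtain ⟨ps, h1, h2⟩ := h
  exact ⟨ps, h1.trans hc, h2⟩

theorem cov_step {α : Type*} {k : ℕ} {X : List α} {a b c : ℕ} (h : Cov k X a c)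
    (hab : a ≤ b) (hb : b ≤ X.length) (hp : PerOn k X a b) : Cov k X b (c + 1) := by
  obtain ⟨ps, h1, h2, h3⟩ := h
  refine ⟨ps ++ [(X.drop a).take (b - a)], by simpa using h1, ?_, ?_⟩
  · have : b = a + (b - a) := by omega
    conv_rhs => rw [this, List.take_add]
    simp [h2]
  · intro P hP
    rcases List.mem_append.1 hP with hP | hP
    · exact h3 P hP
    · rw [List.mem_singleton.1 hP]
      exact (perOn_iff k X a b hab hb).2 hp

theorem bp_le_of_cov {α : Type*} {k : ℕ} {X : List α} {c : ℕ} (h : Cov k X X.length c) :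
    BP k X ≤ c := by
  obtain ⟨ps, h1, h2, h3⟩ := h
  have : BP k X ≤ ps.length := Nat.sInf_le ⟨ps, rfl, by simpa using h2, h3⟩
  exact this.trans h1

theorem mem_breaks {α : Type*} {k : ℕ} {X : List α} {i : ℕ} :
    i ∈ breaks k X ↔ k ∣ i ∧ i + 3 * k ≤ X.length ∧ ¬ PerOn k X i (i + 3 * k) := by
  classical
  unfold breaks
  rw [Finset.mem_filter, Finset.mem_range]
  constructor
  · rintro ⟨_, h1, h2, h3⟩
    refine ⟨h1, h2, fun h => h3 ?_⟩
    have := (perOn_iff k X i (i + 3 * k) (by omega) h2).2 h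
    rwa [show i + 3 * k - i = 3 * k by omega] at this
  · rintro ⟨h1, h2, h3⟩
    refine ⟨by omega, h1, h2, fun h => h3 ?_⟩
    apply (perOn_iff k X i (i + 3 * k) (by omega) h2).1
    rwa [show i + 3 * k - i = 3 * k by omega]

theorem upper_inv {α : Type*} (k : ℕ) (hk : 2 ≤ k) (X : List α) (j : ℕ)
    (hj : (j + 2) * k ≤ X.length) :
    ∃ s, s ≤ j ∧ Cov k X (s * k) ((breaks k X).filter (· < j * k)).card ∧
      (s = j ∨ PerOn k X (s * k) ((j + 2) * k)) := by
  induction j with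
  | zero => exact ⟨0, le_rfl, ⟨[], by simp, by simp, by simp⟩, Or.inl rfl⟩
  | succ j ih =>
    have e3 : (j + 1 + 2) * k = j * k + 3 * k := by ring
    have e2 : (j + 2) * k = j * k + 2 * k := by ring
    have e1 : (j + 1) * k = j * k + k := by ring
    rw [e3] at hj
    obtain ⟨s, hs, hcov, hper⟩ := ih (by omega)
    have hsk : s * k ≤ j * k := Nat.mul_le_mul_right k hs
    by_cases hbr : j * k ∈ breaks k X
    · refine ⟨j + 1, le_rfl, ?_, Or.inl rfl⟩
      have hP : PerOn k X (s * k) ((j + 1) * k) := by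
        rcases hper with rfl | h
        · exact perOn_short (by omega) (by omega)
        · exact perOn_mono le_rfl (by omega) h
      refine cov_mono (cov_step hcov (by omega) (by omega) hP) ?_
      apply Finset.card_lt_card
      rw [Finset.ssubset_iff_of_subset]
      · exact ⟨j * k, by simp [hbr]; omega, by simp⟩
      · intro x hx
        simp only [Finset.mem_filter] at hx ⊢
        exact ⟨hx.1, by omega⟩
    · have hP : PerOn k X (j * k) (j * k + 3 * k) := by
        by_contra h
        exact hbr (mem_breaks.2 ⟨Dvd.intro_left j rfl, hj, h⟩)
      refine ⟨s, by omega, cov_mono hcov ?_, Or.inr ?_⟩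
      · apply Finset.card_le_card
        intro x hx
        simp only [Finset.mem_filter] at hx ⊢
        exact ⟨hx.1, by omega⟩
      · rw [e3]
        rcases hper with rfl | h
        · exact hP
        · exact perOn_merge hsk (by omega) h hP

theorem upper {α : Type*} (k : ℕ) (hk : 2 ≤ k) (X : List α) :
    BP k X ≤ (breaks k X).card + 3 := by
  apply bp_le_of_cov
  have h0 : Cov k X 0 0 := ⟨[], by simp, by simp, by simp⟩
  by_cases hn : X.length < 2 * k
  · have h1 := cov_step h0 (b := min k X.length) (by omega) (by omega)
      (perOn_short (by omega) (by omega))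
    have h2 := cov_step h1 (b := X.length) (by omega) (by omega)
      (perOn_short (by omega) (by omega))
    exact cov_mono h2 (by omega)
  · obtain ⟨j, hj⟩ : ∃ j, X.length / k = j + 2 := by
      have := (Nat.le_div_iff_mul_le (by omega : 0 < k)).2 (by omega : 2 * k ≤ X.length)
      exact ⟨X.length / k - 2, by omega⟩
    have hlo : (j + 2) * k ≤ X.length := hj ▸ Nat.div_mul_le_self _ _
    have hhi : X.length < (j + 2) * k + k := by
      have := Nat.lt_div_mul_add (a := X.length) (by omega : 0 < k)
      rwa [hj] at this
    have e2 : (j + 2) * k = j * k + 2 * k := by ring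
    obtain ⟨s, hs, hcov, hper⟩ := upper_inv k hk X j hlo
    have hsk : s * k ≤ j * k := Nat.mul_le_mul_right k hs
    have hcov' := cov_mono hcov (Finset.card_filter_le _ _)
    have h2 : Cov k X ((j + 2) * k) ((breaks k X).card + 2) := by
      rcases hper with rfl | h
      · have h1 := cov_step hcov' (b := s * k + k) (by omega) (by omega)
          (perOn_short (by omega) (by omega))
        exact cov_step h1 (by omega) (by omega) (perOn_short (by omega) (by omega))
      · exact cov_mono (cov_step hcov' (by omega) (by omega) h) (by omega)
    exact cov_step h2 (by omega) le_rfl (perOn_short (by omega) (by omega))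

theorem lower_parts {α : Type*} (k : ℕ) (hk : 2 ≤ k) (parts : List (List α))
    (h : ∀ P ∈ parts, IsPeriodic k P) :
    (breaks k parts.flatten).card ≤ 3 * parts.length := by
  induction parts using List.reverseRecOn with
  | nil =>
    have : breaks k ([] : List (List α)).flatten = ∅ := by
      ext i
      rw [mem_breaks]
      simp
      omega
    rw [this]
    simp
  | append_singleton ps P ih =>
    have ih' := ih fun Q hQ => h Q (by simp [hQ])
    have hP : IsPeriodic k P := h P (by simp)
    have hfl : (ps ++ [P]).flatten = ps.flatten ++ P := by simp
    rw [hfl]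
    generalize ps.flatten = Y at *
    set a := Y.length with ha
    have hsub : breaks k (Y ++ P) ⊆
        breaks k Y ∪ (Finset.Icc ((a - 1) / k - 2) ((a - 1) / k)).image (· * k) := by
      intro i hi
      rw [mem_breaks] at hi
      obtain ⟨⟨m, rfl⟩, h2, h3⟩ := hi
      rw [Finset.mem_union]
      by_cases hle : k * m + 3 * k ≤ a
      · left
        rw [mem_breaks]
        refine ⟨Dvd.intro m rfl, hle, fun hper => h3 ?_⟩
        obtain ⟨q, hq1, hqk, hq⟩ := hper
        refine ⟨q, hq1, hqk, fun i hi hi' => ?_⟩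
        rw [List.getElem?_append_left (by omega), List.getElem?_append_left (by omega)]
        exact hq i hi hi'
      · right
        have hlt : k * m < a := by
          by_contra hge
          apply h3
          obtain ⟨q, hq1, hqk, hq⟩ := hP
          refine ⟨q, hq1, hqk, fun i hi hi' => ?_⟩
          rw [List.length_append] at h2
          rw [List.getElem?_append_right (by omega), List.getElem?_append_right (by omega)]
          have := hq (i - Y.length) (by omega)
          rwa [show i - Y.length + q = i + q - Y.length by omega] at this
        rw [Finset.mem_image]
        refine ⟨m, ?_, mul_comm _ _⟩
        rw [Finset.mem_Icc]
        have l1 : m ≤ (a - 1) / k :=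
          (Nat.le_div_iff_mul_le (by omega)).2 (by rw [mul_comm]; omega)
        have l2 : (a - 1) / k < m + 3 :=
          (Nat.div_lt_iff_lt_mul (by omega)).2 (by
            have : (m + 3) * k = k * m + 3 * k := by ring
            omega)
        omega
    have c1 := Finset.card_le_card hsub
    have c2 := Finset.card_union_le (breaks k Y)
      ((Finset.Icc ((a - 1) / k - 2) ((a - 1) / k)).image (· * k))
    have c3 : ((Finset.Icc ((a - 1) / k - 2) ((a - 1) / k)).image (· * k)).card ≤ 3 := by
      refine Finset.card_image_le.trans ?_
      rw [Nat.card_Icc]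
      omega
    rw [List.length_append, List.length_singleton]
    omega

/-- The number `b` of `k`-breaks approximates the `k`-block periodicity:
`b/3 ≤ BP_k(X) ≤ b + 3`. -/
theorem breaks_approx_bp {α : Type*} (k : ℕ) (hk : 2 ≤ k) (X : List α) :
    (breaks k X).card ≤ 3 * BP k X ∧ BP k X ≤ (breaks k X).card + 3 := by
  refine ⟨?_, upper k hk X⟩
  have hne : {L | ∃ parts : List (List α), parts.length = L ∧ parts.flatten = X ∧
      ∀ P ∈ parts, IsPeriodic k P}.Nonempty := by
    refine ⟨_, X.map (fun x => [x]), rfl, ?_, ?_⟩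
    · clear hk
      induction X with
      | nil => rfl
      | cons x xs ih => simp [List.flatten_cons, ih]
    intro P hP
    obtain ⟨x, _, rfl⟩ := List.mem_map.1 hP
    refine ⟨1, le_rfl, by omega, fun i hi => ?_⟩
    simp at hi
  obtain ⟨parts, h1, h2, h3⟩ := Nat.sInf_mem hne
  have := lower_parts k hk parts h3
  rw [h2, h1] at this
  exact this
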